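/- Let J : ℍ → ℍ be an ℝ-linear map with J ∘ J = −id which preserves the standard inner product of ℍ ≅ ℝ⁴. Then there exists a purely imaginary quaternion q with ‖q‖ = 1 such that either J(x) = q·x for all x ∈ ℍ, or J(x) = x·q for all x ∈ ℍ. (Hence the orthogonal complex structures on ℝ⁴ form the two families parameterized by the twistor fibers ℙ⁺ and ℙ⁻.) -/

import Mathlib

open scoped Quaternion InnerProductSpace

/-- A linear map squaring to `-id` and preserving the inner product is skew-adjoint. -/
lemma inner_map_left_eq_neg_of_sq_eq_neg_id {E : Type*} [NormedAddCommGroup E]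
    [InnerProductSpace ℝ E] (J : E →ₗ[ℝ] E) (hJ2 : J ∘ₗ J = -LinearMap.id)
    (hJinner : ∀ x y : E, ⟪J x, J y⟫_ℝ = ⟪x, y⟫_ℝ) (x y : E) :
    ⟪J x, y⟫_ℝ = -⟪x, J y⟫_ℝ := by
  have h : J (J x) = -x := LinearMap.congr_fun hJ2 x
  rw [← hJinner (J x) y, h, inner_neg_left]

/-- The real inner product of quaternions in coordinates. -/
lemma Quaternion.inner_eq_sum_coords (x y : ℍ[ℝ]) :
    ⟪x, y⟫_ℝ = x.re * y.re + x.imI * y.imI + x.imJ * y.imJ + x.imK * y.imK := by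
  simp [Quaternion.inner_def]

/-- Two real-linear maps on the quaternions agreeing on `1, i, j, k` are equal. -/
lemma Quaternion.linearMap_ext_basis {M : Type*} [AddCommGroup M] [Module ℝ M]
    {f g : ℍ[ℝ] →ₗ[ℝ] M} {e₀ e₁ e₂ e₃ : ℍ[ℝ]}
    (he₀ : e₀ = ⟨1, 0, 0, 0⟩) (he₁ : e₁ = ⟨0, 1, 0, 0⟩)
    (he₂ : e₂ = ⟨0, 0, 1, 0⟩) (he₃ : e₃ = ⟨0, 0, 0, 1⟩)
    (h₀ : f e₀ = g e₀) (h₁ : f e₁ = g e₁) (h₂ : f e₂ = g e₂) (h₃ : f e₃ = g e₃) :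
    f = g := by
  refine LinearMap.ext fun x ↦ ?_
  have hx : x = x.re • e₀ + x.imI • e₁ + x.imJ • e₂ + x.imK • e₃ := by
    ext <;> simp only [Quaternion.re_add, Quaternion.imI_add, Quaternion.imJ_add,
      Quaternion.imK_add, Quaternion.re_smul, Quaternion.imI_smul, Quaternion.imJ_smul,
      Quaternion.imK_smul] <;> simp [he₀, he₁, he₂, he₃]
  rw [hx]
  simp only [map_add, map_smul, h₀, h₁, h₂, h₃]

/-- If all products of values of two functions vanish, then one of the functions vanishes. -/
lemma forall_eq_zero_or_forall_eq_zero_of_mul_eq_zero {ι R : Type*} [MulZeroClass R]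
    [NoZeroDivisors R] {u v : ι → R} (h : ∀ m n, u m * v n = 0) :
    (∀ m, u m = 0) ∨ (∀ n, v n = 0) := by
  by_contra! hc
  obtain ⟨⟨m, hm⟩, n, hn⟩ := hc
  exact mul_ne_zero hm hn (h m n)

/-- Every `ℝ`-linear map `J : ℍ → ℍ` with `J ∘ J = -id` preserving the standard inner product
of `ℍ ≅ ℝ⁴` is either left or right multiplication by some purely imaginary unit quaternion:
the orthogonal complex structures on `ℝ⁴` form the two twistor families `ℙ⁺` and `ℙ⁻`. -/
theorem orthogonal_complex_structure_eq_quaternion_mul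
    (J : ℍ[ℝ] →ₗ[ℝ] ℍ[ℝ]) (hJ2 : J ∘ₗ J = -LinearMap.id)
    (hJinner : ∀ x y : ℍ[ℝ], ⟪J x, J y⟫_ℝ = ⟪x, y⟫_ℝ) :
    ∃ q : ℍ[ℝ], q.re = 0 ∧ ‖q‖ = 1 ∧
      ((∀ x : ℍ[ℝ], J x = q * x) ∨ (∀ x : ℍ[ℝ], J x = x * q)) := by
  have hskew := inner_map_left_eq_neg_of_sq_eq_neg_id J hJ2 hJinner
  simp only [Quaternion.inner_eq_sum_coords] at hskew hJinner
  obtain ⟨e₀, he₀⟩ : ∃ e : ℍ[ℝ], e = ⟨1, 0, 0, 0⟩ := ⟨_, rfl⟩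
  obtain ⟨e₁, he₁⟩ : ∃ e : ℍ[ℝ], e = ⟨0, 1, 0, 0⟩ := ⟨_, rfl⟩
  obtain ⟨e₂, he₂⟩ : ∃ e : ℍ[ℝ], e = ⟨0, 0, 1, 0⟩ := ⟨_, rfl⟩
  obtain ⟨e₃, he₃⟩ : ∃ e : ℍ[ℝ], e = ⟨0, 0, 0, 1⟩ := ⟨_, rfl⟩
  have hc₀ : e₀.re = 1 ∧ e₀.imI = 0 ∧ e₀.imJ = 0 ∧ e₀.imK = 0 := by simp [he₀]
  have hc₁ : e₁.re = 0 ∧ e₁.imI = 1 ∧ e₁.imJ = 0 ∧ e₁.imK = 0 := by simp [he₁]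
  have hc₂ : e₂.re = 0 ∧ e₂.imI = 0 ∧ e₂.imJ = 1 ∧ e₂.imK = 0 := by simp [he₂]
  have hc₃ : e₃.re = 0 ∧ e₃.imI = 0 ∧ e₃.imJ = 0 ∧ e₃.imK = 1 := by simp [he₃]
  have s00 : (J e₀).re = 0 := by have := hskew e₀ e₀; simp [hc₀] at this; linarith
  have s11 : (J e₁).imI = 0 := by have := hskew e₁ e₁; simp [hc₁] at this; linarith
  have s22 : (J e₂).imJ = 0 := by have := hskew e₂ e₂; simp [hc₂] at this; linarith
  have s33 : (J e₃).imK = 0 := by have := hskew e₃ e₃; simp [hc₃] at this; linarith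
  have s10 : (J e₁).re = -(J e₀).imI := by simpa [hc₀, hc₁] using hskew e₁ e₀
  have s20 : (J e₂).re = -(J e₀).imJ := by simpa [hc₀, hc₂] using hskew e₂ e₀
  have s30 : (J e₃).re = -(J e₀).imK := by simpa [hc₀, hc₃] using hskew e₃ e₀
  have s21 : (J e₂).imI = -(J e₁).imJ := by simpa [hc₁, hc₂] using hskew e₂ e₁
  have s31 : (J e₃).imI = -(J e₁).imK := by simpa [hc₁, hc₃] using hskew e₃ e₁
  have s32 : (J e₃).imJ = -(J e₂).imK := by simpa [hc₂, hc₃] using hskew e₃ e₂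
  have o00 := hJinner e₀ e₀
  have o11 := hJinner e₁ e₁
  have o22 := hJinner e₂ e₂
  have o33 := hJinner e₃ e₃
  have o01 := hJinner e₀ e₁
  have o02 := hJinner e₀ e₂
  have o03 := hJinner e₀ e₃
  have o12 := hJinner e₁ e₂
  have o13 := hJinner e₁ e₃
  have o23 := hJinner e₂ e₃
  simp only [s00, s11, s22, s33, s10, s20, s30, s21, s31, s32, hc₀, hc₁, hc₂, hc₃]
    at o00 o11 o22 o33 o01 o02 o03 o12 o13 o23
  have key := forall_eq_zero_or_forall_eq_zero_of_mul_eq_zero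
    (u := ![(J e₂).imK - (J e₀).imI, (J e₁).imK + (J e₀).imJ, (J e₁).imJ - (J e₀).imK])
    (v := ![(J e₂).imK + (J e₀).imI, (J e₁).imK - (J e₀).imJ, (J e₁).imJ + (J e₀).imK]) (by
      intro m n
      fin_cases m <;> fin_cases n <;> simp [-mul_eq_zero] <;> linarith)
  refine ⟨J e₀, s00, ?_, ?_⟩
  · rw [norm_eq_sqrt_real_inner, Quaternion.inner_eq_sum_coords, Real.sqrt_eq_one, s00]
    linarith
  · refine key.imp (fun h ↦ ?_) (fun h ↦ ?_)
    · have h0 := h 0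
      have h1 := h 1
      have h2 := h 2
      simp at h0 h1 h2
      have hJ : J = LinearMap.mulLeft ℝ (J e₀) := by
        apply Quaternion.linearMap_ext_basis he₀ he₁ he₂ he₃ <;>
          rw [LinearMap.mulLeft_apply] <;> ext <;>
          simp [hc₀, hc₁, hc₂, hc₃] <;> linarith
      exact fun x ↦ LinearMap.congr_fun hJ x
    · have h0 := h 0
      have h1 := h 1
      have h2 := h 2
      simp at h0 h1 h2
      have hJ : J = LinearMap.mulRight ℝ (J e₀) := by
        apply Quaternion.linearMap_ext_basis he₀ he₁ he₂ he₃ <;>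
          rw [LinearMap.mulRight_apply] <;> ext <;>
          simp [hc₀, hc₁, hc₂, hc₃] <;> linarith
      exact fun x ↦ LinearMap.congr_fun hJ x
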